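/- Under the two-level hierarchical linear regression model, the total expected excess risk of the bottom-up OLS estimators over all K children nodes satisfies Σ_{i=1}^K E[r_i(θ̂ᵇ_i)] ≥ Σ_{i=1}^K (s_i + p_i²) · σ² · d/(n−d−1). -/

import Mathlib

open MeasureTheory ProbabilityTheory Matrix Finset

noncomputable section

/-- The product of `d` independent standard Gaussians on `Fin d → ℝ`. -/
def stdGaussianPi (d : ℕ) : Measure (Fin d → ℝ) :=
  Measure.pi fun _ => gaussianReal 0 1

/-- `μ` is the centered multivariate Gaussian distribution on `ℝ^d` with covariance
matrix `C`, i.e. the law of `A z` where `z` is a standard Gaussian vector and `A Aᵀ = C`. -/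
def IsCenteredGaussian {d : ℕ} (μ : Measure (Fin d → ℝ))
    (C : Matrix (Fin d) (Fin d) ℝ) : Prop :=
  ∃ A : Matrix (Fin d) (Fin d) ℝ, A * Aᵀ = C ∧ μ = (stdGaussianPi d).map (fun z => A.mulVec z)

/-- Sample space for the two-level hierarchical linear regression model with `n` time steps:
a point `ω = (x, η, a)` records the covariates `x t : ℝ^d`, the noises `η t : ℝ`, and the
proportion vectors `a t : ℝ^K`, for `t = 1, …, n`. -/
abbrev HierOmega (d n K : ℕ) : Type :=
  (Fin n → (Fin d → ℝ)) × (Fin n → ℝ) × (Fin n → (Fin K → ℝ))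

/-- The joint law of the model: the covariates are i.i.d. with law `νx`, the noises are
i.i.d. with law `νη`, the proportion vectors are i.i.d. with law `νa`, and the three
families are mutually independent. -/
def hierMeasure (d n K : ℕ) (νx : Measure (Fin d → ℝ)) (νη : Measure ℝ)
    (νa : Measure (Fin K → ℝ)) : Measure (HierOmega d n K) :=
  (Measure.pi fun _ : Fin n => νx).prod
    ((Measure.pi fun _ : Fin n => νη).prod (Measure.pi fun _ : Fin n => νa))

variable {d n K : ℕ}

/-- The empirical second-moment matrix `S = ∑ t, x_t x_tᵀ`. -/
def Smat (ω : HierOmega d n K) : Matrix (Fin d) (Fin d) ℝ :=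
  ∑ t, vecMulVec (ω.1 t) (ω.1 t)

/-- The root value at time `t`: `y_{t,0} = θ₀ᵀ x_t + η_t`. -/
def yRoot (θ₀ : Fin d → ℝ) (t : Fin n) (ω : HierOmega d n K) : ℝ :=
  θ₀ ⬝ᵥ ω.1 t + ω.2.1 t

/-- The value of child `i` at time `t`: `y_{t,i} = a_{t,i} · y_{t,0}`. -/
def yChild (θ₀ : Fin d → ℝ) (i : Fin K) (t : Fin n) (ω : HierOmega d n K) : ℝ :=
  ω.2.2 t i * yRoot θ₀ t ω

/-- The bottom-up OLS estimator for child `i`: `θ̂ᵇ_i = S⁻¹ ∑ t, x_t y_{t,i}`. -/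
def thetaBU (θ₀ : Fin d → ℝ) (i : Fin K) (ω : HierOmega d n K) : Fin d → ℝ :=
  (Smat ω)⁻¹.mulVec (∑ t, yChild θ₀ i t ω • ω.1 t)

/-- The root OLS estimator `θ̂₀ = S⁻¹ ∑ t, x_t y_{t,0}`. -/
def thetaRoot (θ₀ : Fin d → ℝ) (ω : HierOmega d n K) : Fin d → ℝ :=
  (Smat ω)⁻¹.mulVec (∑ t, yRoot θ₀ t ω • ω.1 t)

/-- The estimated proportion `p̂_i = (1/n) ∑ t, a_{t,i}`. -/
def pHat (i : Fin K) (ω : HierOmega d n K) : ℝ :=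
  (∑ t, ω.2.2 t i) / n

/-- The top-down estimator for child `i`: `θ̂ᵗ_i = p̂_i θ̂₀`. -/
def thetaTD (θ₀ : Fin d → ℝ) (i : Fin K) (ω : HierOmega d n K) : Fin d → ℝ :=
  pHat i ω • thetaRoot θ₀ ω

/-- The excess risk of an estimate `est` for the target coefficient vector `tgt`,
with respect to the covariance `C`: `(est − tgt)ᵀ C (est − tgt)`. -/
def excessRisk (C : Matrix (Fin d) (Fin d) ℝ) (tgt est : Fin d → ℝ) : ℝ :=
  (est - tgt) ⬝ᵥ C.mulVec (est - tgt)

section GaussianInverseMoment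

open scoped RealInnerProductSpace ENNReal

open Module (finrank)

lemma integral_exp_neg_mul_sq_gaussianReal {t : ℝ} (ht : 0 ≤ t) :
    ∫ x, Real.exp (-t * x ^ 2) ∂(gaussianReal 0 1) = (1 + 2 * t) ^ (-(1 / 2) : ℝ) := by
  rw [integral_gaussianReal_eq_integral_smul one_ne_zero]
  have h : ∀ x : ℝ, gaussianPDFReal 0 1 x • Real.exp (-t * x ^ 2) =
      (√(2 * Real.pi))⁻¹ * Real.exp (-(t + 1 / 2) * x ^ 2) := fun x ↦ by
    rw [gaussianPDFReal, smul_eq_mul, mul_assoc, ← Real.exp_add]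
    simp only [NNReal.coe_one, mul_one, sub_zero]
    ring_nf
  simp_rw [h]
  rw [integral_const_mul, integral_gaussian, ← Real.sqrt_inv, ← Real.sqrt_mul (by positivity),
    Real.rpow_neg (by positivity), ← Real.sqrt_eq_rpow, ← Real.sqrt_inv]
  congr 1
  have := Real.pi_pos
  field_simp
  ring

variable {E : Type*} [NormedAddCommGroup E] [InnerProductSpace ℝ E] [FiniteDimensional ℝ E]
  [MeasurableSpace E] [BorelSpace E]

lemma integral_exp_neg_mul_norm_sq_stdGaussian {t : ℝ} (ht : 0 ≤ t) :
    ∫ x, Real.exp (-t * ‖x‖ ^ 2) ∂(stdGaussian E) =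
      (1 + 2 * t) ^ (-(finrank ℝ E / 2) : ℝ) := by
  rw [stdGaussian, integral_map (Measurable.aemeasurable (by fun_prop))
    (Measurable.aestronglyMeasurable (by fun_prop))]
  have h : ∀ x : Fin (finrank ℝ E) → ℝ,
      Real.exp (-t * ‖∑ i, x i • stdOrthonormalBasis ℝ E i‖ ^ 2) =
        ∏ i, Real.exp (-t * x i ^ 2) := fun x ↦ by
    rw [← Real.exp_sum, ← Finset.mul_sum, ← real_inner_self_eq_norm_sq,
      (stdOrthonormalBasis ℝ E).orthonormal.inner_sum]
    simp [sq]
  simp_rw [h]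
  rw [integral_fintype_prod_eq_prod (f := fun _ x ↦ Real.exp (-t * x ^ 2))]
  simp_rw [integral_exp_neg_mul_sq_gaussianReal ht]
  rw [Finset.prod_const, Finset.card_univ, Fintype.card_fin, ← Real.rpow_natCast,
    ← Real.rpow_mul (by positivity)]
  ring_nf

lemma lintegral_exp_neg_mul_norm_sq_stdGaussian {t : ℝ} (ht : 0 ≤ t) :
    ∫⁻ x, ENNReal.ofReal (Real.exp (-t * ‖x‖ ^ 2)) ∂(stdGaussian E) =
      ENNReal.ofReal ((1 + 2 * t) ^ (-(finrank ℝ E / 2) : ℝ)) := by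
  rw [← integral_exp_neg_mul_norm_sq_stdGaussian ht, ofReal_integral_eq_lintegral_ofReal _
    (ae_of_all _ fun _ ↦ (Real.exp_pos _).le)]
  refine Integrable.of_bound (Measurable.aestronglyMeasurable (by fun_prop)) 1
    (ae_of_all _ fun x ↦ ?_)
  rw [Real.norm_eq_abs, Real.abs_exp, Real.exp_le_one_iff]
  nlinarith [mul_nonneg ht (sq_nonneg ‖x‖)]

lemma lintegral_Ioi_exp_neg_mul {r : ℝ} (hr : 0 ≤ r) :
    ∫⁻ t in Set.Ioi (0 : ℝ), ENNReal.ofReal (Real.exp (-t * r)) = (ENNReal.ofReal r)⁻¹ := by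
  rcases hr.eq_or_lt with rfl | hr
  · simp
  · have h : ∀ t : ℝ, -t * r = -r * t := fun t ↦ by ring
    simp_rw [h]
    rw [← ofReal_integral_eq_lintegral_ofReal
        (integrableOn_exp_mul_Ioi (neg_lt_zero.2 hr) 0) (ae_of_all _ fun _ ↦ (Real.exp_pos _).le),
      integral_exp_mul_Ioi (neg_lt_zero.2 hr), ← ENNReal.ofReal_inv_of_pos hr]
    simp

lemma lintegral_Ioi_one_add_two_mul_rpow {m : ℝ} (hm : 2 < m) :
    ∫⁻ t in Set.Ioi (0 : ℝ), ENNReal.ofReal ((1 + 2 * t) ^ (-(m / 2))) =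
      ENNReal.ofReal (1 / (m - 2)) := by
  have hd : ∀ x ∈ Set.Ioi (0 : ℝ), HasDerivAt
      (fun t : ℝ ↦ -(1 / (m - 2)) * (1 + 2 * t) ^ (1 - m / 2))
      ((1 + 2 * x) ^ (-(m / 2))) x := fun x hx ↦ by
    have hx' : 0 < 1 + 2 * x := by have := Set.mem_Ioi.1 hx; linarith
    have h1 : HasDerivAt (fun t : ℝ ↦ 1 + 2 * t) 2 x := by
      simpa using ((hasDerivAt_id x).const_mul 2).const_add 1
    have := (h1.rpow_const (p := 1 - m / 2) (Or.inl hx'.ne')).const_mul (-(1 / (m - 2)))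
    refine this.congr_deriv ?_
    have h2 : m - 2 ≠ 0 := by linarith
    rw [show 1 - m / 2 - 1 = -(m / 2) by ring]
    field_simp
    ring
  have hc : ContinuousWithinAt (fun t : ℝ ↦ -(1 / (m - 2)) * (1 + 2 * t) ^ (1 - m / 2))
      (Set.Ici 0) 0 := by
    refine ContinuousAt.continuousWithinAt ?_
    refine continuousAt_const.mul (ContinuousAt.rpow_const (by fun_prop) (Or.inl (by simp)))
  have hpos : ∀ x ∈ Set.Ioi (0 : ℝ), 0 ≤ (1 + 2 * x) ^ (-(m / 2)) := fun x hx ↦ by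
    have := Set.mem_Ioi.1 hx
    positivity
  have hlim : Filter.Tendsto (fun t : ℝ ↦ -(1 / (m - 2)) * (1 + 2 * t) ^ (1 - m / 2))
      Filter.atTop (nhds 0) := by
    have h1 : Filter.Tendsto (fun t : ℝ ↦ 1 + 2 * t) Filter.atTop Filter.atTop :=
      Filter.tendsto_atTop_add_const_left _ _ (Filter.tendsto_id.const_mul_atTop two_pos)
    have h2 := (tendsto_rpow_neg_atTop (y := m / 2 - 1) (by linarith)).comp h1
    simpa [Function.comp_def] using h2.const_mul (-(1 / (m - 2)))
  have hint := integrableOn_Ioi_deriv_of_nonneg hc hd hpos hlim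
  rw [← ofReal_integral_eq_lintegral_ofReal hint
    ((ae_restrict_iff' measurableSet_Ioi).2 (ae_of_all _ hpos)),
    integral_Ioi_of_hasDerivAt_of_nonneg hc hd hpos hlim]
  simp

lemma lintegral_inv_norm_sq_stdGaussian (hE : 3 ≤ finrank ℝ E) :
    ∫⁻ x, (ENNReal.ofReal (‖x‖ ^ 2))⁻¹ ∂(stdGaussian E) =
      ENNReal.ofReal (1 / (finrank ℝ E - 2)) := by
  have hE' : (2 : ℝ) < finrank ℝ E := by exact_mod_cast hE
  simp_rw [← lintegral_Ioi_exp_neg_mul (sq_nonneg ‖_‖)]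
  rw [lintegral_lintegral_swap (Measurable.aemeasurable (by fun_prop)),
    ← lintegral_Ioi_one_add_two_mul_rpow hE']
  exact setLIntegral_congr_fun measurableSet_Ioi fun t ht ↦
    lintegral_exp_neg_mul_norm_sq_stdGaussian (le_of_lt ht)

lemma stdGaussian_map_orthogonalProjectionOnto (V : Submodule ℝ E) :
    (stdGaussian E).map V.orthogonalProjectionOnto = stdGaussian V := by
  apply Measure.ext_of_charFun
  ext t
  rw [charFun_stdGaussian, charFun_apply, integral_map (by fun_prop) (by fun_prop)]
  simp_rw [Submodule.inner_orthogonalProjectionOnto_eq_of_mem_right]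
  rw [← charFun_apply, charFun_stdGaussian]
  simp

lemma indepFun_orthogonalProjectionOnto_stdGaussian (V : Submodule ℝ E) :
    IndepFun V.orthogonalProjectionOnto Vᗮ.orthogonalProjectionOnto (stdGaussian E) := by
  rw [indepFun_iff_charFun_prod (by fun_prop) (by fun_prop)]
  intro t
  rw [stdGaussian_map_orthogonalProjectionOnto, stdGaussian_map_orthogonalProjectionOnto,
    charFun_stdGaussian, charFun_stdGaussian, charFun_apply, integral_map (by fun_prop)
    (by fun_prop)]
  simp_rw [WithLp.prod_inner_apply, Submodule.inner_orthogonalProjectionOnto_eq_of_mem_right,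
    ← inner_add_right]
  rw [← charFun_apply, charFun_stdGaussian, ← Complex.exp_add]
  have h : ‖(t.ofLp.1 : E) + t.ofLp.2‖ ^ 2 = ‖t.ofLp.1‖ ^ 2 + ‖t.ofLp.2‖ ^ 2 := by
    rw [norm_add_sq_real, Submodule.inner_right_of_mem_orthogonal t.ofLp.1.2 t.ofLp.2.2]
    simp
  have h' := congrArg ((↑) : ℝ → ℂ) h
  push_cast at h'
  rw [h']
  ring_nf

lemma lintegral_inv_norm_sq_orthogonalProjectionOnto {V : Submodule ℝ E} (hV : 3 ≤ finrank ℝ V) :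
    ∫⁻ y, (ENNReal.ofReal (‖V.orthogonalProjectionOnto y‖ ^ 2))⁻¹ ∂(stdGaussian E) =
      ENNReal.ofReal (1 / (finrank ℝ V - 2)) := by
  rw [← lintegral_inv_norm_sq_stdGaussian hV, ← stdGaussian_map_orthogonalProjectionOnto,
    lintegral_map (by fun_prop) (by fun_prop)]

lemma lintegral_norm_sq_stdGaussian_lt_top :
    ∫⁻ y, ENNReal.ofReal (‖y‖ ^ 2) ∂(stdGaussian E) < ∞ := by
  have h : MemLp id 2 (stdGaussian E) := IsGaussian.memLp_two_id
  exact (h.integrable_norm_pow two_ne_zero).lintegral_lt_top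

lemma lintegral_inv_norm_sq_orthogonalProjectionOnto_mul_norm_sq_le {V : Submodule ℝ E}
    (hV : 3 ≤ finrank ℝ V) :
    ∫⁻ y, (ENNReal.ofReal (‖V.orthogonalProjectionOnto y‖ ^ 2))⁻¹ * ENNReal.ofReal (‖y‖ ^ 2)
        ∂(stdGaussian E) ≤
      1 + ENNReal.ofReal (1 / (finrank ℝ V - 2)) *
        ∫⁻ y, ENNReal.ofReal (‖y‖ ^ 2) ∂(stdGaussian E) := by
  have hm : AEMeasurable (fun y : E ↦ (ENNReal.ofReal (‖V.orthogonalProjectionOnto y‖ ^ 2))⁻¹)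
      (stdGaussian E) := by fun_prop
  have hm' : AEMeasurable (fun y : E ↦ ENNReal.ofReal (‖Vᗮ.orthogonalProjectionOnto y‖ ^ 2))
      (stdGaussian E) := by fun_prop
  have hind : IndepFun (fun y : E ↦ (ENNReal.ofReal (‖V.orthogonalProjectionOnto y‖ ^ 2))⁻¹)
      (fun y : E ↦ ENNReal.ofReal (‖Vᗮ.orthogonalProjectionOnto y‖ ^ 2)) (stdGaussian E) :=
    (indepFun_orthogonalProjectionOnto_stdGaussian V).comp
      (φ := fun v ↦ (ENNReal.ofReal (‖v‖ ^ 2))⁻¹) (ψ := fun v ↦ ENNReal.ofReal (‖v‖ ^ 2))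
      (by fun_prop) (by fun_prop)
  calc
    _ ≤ ∫⁻ y, (1 + (ENNReal.ofReal (‖V.orthogonalProjectionOnto y‖ ^ 2))⁻¹ *
          ENNReal.ofReal (‖Vᗮ.orthogonalProjectionOnto y‖ ^ 2)) ∂(stdGaussian E) := by
      refine lintegral_mono fun y ↦ ?_
      have h : ‖y‖ ^ 2 = ‖V.orthogonalProjectionOnto y‖ ^ 2 +
          ‖Vᗮ.orthogonalProjectionOnto y‖ ^ 2 := V.norm_sq_eq_add_norm_sq_projection y
      dsimp only
      rw [h, ENNReal.ofReal_add (by positivity) (by positivity), mul_add]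
      gcongr
      exact ENNReal.inv_mul_le_one _
    _ = 1 + ENNReal.ofReal (1 / (finrank ℝ V - 2)) *
        ∫⁻ y, ENNReal.ofReal (‖Vᗮ.orthogonalProjectionOnto y‖ ^ 2) ∂(stdGaussian E) := by
      rw [lintegral_add_left measurable_const,
        lintegral_mul_eq_lintegral_mul_lintegral_of_indepFun'' hm hm' hind,
        lintegral_inv_norm_sq_orthogonalProjectionOnto hV]
      simp
    _ ≤ _ := by
      gcongr with y
      exact Vᗮ.norm_orthogonalProjectionOnto_apply_le y

end GaussianInverseMoment

section GramInverse

open scoped RealInnerProductSpace ENNReal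

open Module (finrank)

lemma measurable_det_of_entries {α ι : Type*} [MeasurableSpace α] [Fintype ι] [DecidableEq ι]
    {f : α → Matrix ι ι ℝ} (hf : ∀ i j, Measurable fun a ↦ f a i j) :
    Measurable fun a ↦ (f a).det := by
  simp_rw [det_apply]
  fun_prop

lemma measurable_inv_apply_of_entries {α ι : Type*} [MeasurableSpace α] [Fintype ι]
    [DecidableEq ι] {f : α → Matrix ι ι ℝ} (hf : ∀ i j, Measurable fun a ↦ f a i j) (i j : ι) :
    Measurable fun a ↦ (f a)⁻¹ i j := by
  simp_rw [Matrix.inv_def, Ring.inverse_eq_inv', Matrix.smul_apply, smul_eq_mul, adjugate_apply]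
  refine (measurable_det_of_entries hf).inv.mul (measurable_det_of_entries fun k l ↦ ?_)
  by_cases hk : k = j
  · subst hk
    simp
  · simpa [updateRow_ne hk] using hf k l

lemma measurePreserving_update {ι : Type*} [Fintype ι] [DecidableEq ι] {α : ι → Type*}
    [∀ i, MeasurableSpace (α i)] (μ : ∀ i, Measure (α i)) [∀ i, IsProbabilityMeasure (μ i)]
    (i : ι) :
    MeasurePreserving (fun q : (∀ j, α j) × α i ↦ Function.update q.1 i q.2)
      ((Measure.pi μ).prod (μ i)) (Measure.pi μ) := by
  have hm : Measurable fun q : (∀ j, α j) × α i ↦ Function.update q.1 i q.2 := by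
    refine measurable_pi_lambda _ fun j ↦ ?_
    by_cases hj : j = i
    · subst hj
      simpa using measurable_snd
    · simpa [hj, Function.comp_def] using (measurable_pi_apply j).comp measurable_fst
  refine ⟨hm, (Measure.pi_eq fun s hs ↦ ?_).symm⟩
  rw [Measure.map_apply hm (MeasurableSet.univ_pi hs)]
  have h : (fun q : (∀ j, α j) × α i ↦ Function.update q.1 i q.2) ⁻¹' Set.univ.pi s =
      (Set.univ.pi (Function.update s i Set.univ)) ×ˢ s i := by
    ext q
    simp only [Set.mem_preimage, Set.mem_pi, Set.mem_univ, true_implies, Set.mem_prod]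
    constructor
    · refine fun hq ↦ ⟨fun j ↦ ?_, by simpa using hq i⟩
      by_cases hj : j = i
      · subst hj
        simp
      · simpa [hj] using hq j
    · rintro ⟨h1, h2⟩ j
      by_cases hj : j = i
      · subst hj
        simpa using h2
      · simpa [hj] using h1 j
  rw [h, Measure.prod_prod, Measure.pi_pi, ← Finset.prod_erase_mul _ _ (Finset.mem_univ i),
    ← Finset.prod_erase_mul (s := Finset.univ) (fun j ↦ μ j (s j)) (Finset.mem_univ i)]
  simp only [Function.update_self, measure_univ, mul_one]
  congr 1
  refine Finset.prod_congr rfl fun j hj ↦ ?_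
  rw [Function.update_of_ne (Finset.ne_of_mem_erase hj)]

variable {E : Type*} [NormedAddCommGroup E] [InnerProductSpace ℝ E]

lemma gram_inv_diag_eq {ι : Type*} [Fintype ι] [DecidableEq ι] [FiniteDimensional ℝ E]
    {v : ι → E} (hv : LinearIndependent ℝ v) (i : ι) :
    (gram ℝ v)⁻¹ i i =
      (‖(Submodule.span ℝ (v '' {i}ᶜ))ᗮ.orthogonalProjectionOnto (v i)‖ ^ 2)⁻¹ := by
  set V := Submodule.span ℝ (v '' {i}ᶜ)
  set u := (gram ℝ v)⁻¹.col i
  have hu : gram ℝ v *ᵥ u = Pi.single i 1 := by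
    rw [show u = (gram ℝ v)⁻¹ *ᵥ Pi.single i 1 from (mulVec_single_one _ _).symm, mulVec_mulVec,
      mul_nonsing_inv _ (isUnit_iff_ne_zero.2 (det_gram_ne_zero_iff_linearIndependent.2 hv)),
      one_mulVec]
  set w := ∑ j, u j • v j with hw
  have hinner : ∀ k, ⟪v k, w⟫ = (Pi.single i 1 : ι → ℝ) k := fun k ↦ by
    rw [← hu, hw, inner_sum]
    simp [mulVec, dotProduct, real_inner_smul_right, mul_comm]
  have hwV : w ∈ Vᗮ := by
    rw [Submodule.mem_orthogonal]
    intro x hx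
    induction hx using Submodule.span_induction with
    | mem x hx =>
      obtain ⟨k, hk, rfl⟩ := hx
      rw [hinner, Pi.single_eq_of_ne (by simpa using hk)]
    | zero => simp
    | add x y _ _ hx hy => rw [inner_add_left, hx, hy, add_zero]
    | smul a x _ hx => rw [real_inner_smul_left, hx, mul_zero]
  have hproj : Vᗮ.starProjection w = u i • Vᗮ.starProjection (v i) := by
    rw [hw, map_sum, Finset.sum_eq_single i]
    · simp
    · intro k _ hk
      have hkV : v k ∈ V := Submodule.subset_span ⟨k, by simpa using hk, rfl⟩
      rw [map_smul, Submodule.starProjection_orthogonal_apply_eq_zero hkV, smul_zero]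
    · simp
  have h1 : u i * ‖Vᗮ.orthogonalProjectionOnto (v i)‖ ^ 2 = 1 := by
    have h2 : ⟪v i, w⟫ = 1 := by rw [hinner, Pi.single_eq_same]
    rw [← Submodule.starProjection_eq_self_iff.2 hwV, hproj, real_inner_smul_right,
      ← Submodule.starProjection_eq_self_iff.2 (Vᗮ.starProjection_apply_mem (v i)),
      ← Submodule.inner_starProjection_left_eq_right, real_inner_self_eq_norm_sq] at h2
    exact h2
  exact eq_inv_of_mul_eq_one_left h1

lemma finrank_orthogonal_span_image_compl {ι : Type*} [Fintype ι] [DecidableEq ι]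
    [FiniteDimensional ℝ E] {v : ι → E} (hv : LinearIndependent ℝ v) (i : ι) :
    finrank ℝ (Submodule.span ℝ (v '' {i}ᶜ))ᗮ + Fintype.card ι = finrank ℝ E + 1 := by
  have h1 : finrank ℝ (Submodule.span ℝ (v '' {i}ᶜ)) = Fintype.card ι - 1 := by
    rw [Set.image_eq_range]
    refine (finrank_span_eq_card (hv.comp _ Subtype.val_injective)).trans ?_
    rw [Fintype.card_compl_set]
    simp
  have h2 := (Submodule.span ℝ (v '' {i}ᶜ)).finrank_add_finrank_orthogonal
  have h3 : 0 < Fintype.card ι := Fintype.card_pos_iff.2 ⟨i⟩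
  lia

variable [FiniteDimensional ℝ E] [MeasurableSpace E] [BorelSpace E]

lemma ae_notMem_stdGaussian {V : Submodule ℝ E} (hV : 3 ≤ finrank ℝ Vᗮ) :
    ∀ᵐ y ∂(stdGaussian E), y ∉ V := by
  have h : ∫⁻ y, (ENNReal.ofReal (‖Vᗮ.orthogonalProjectionOnto y‖ ^ 2))⁻¹ ∂(stdGaussian E) ≠ ∞ := by
    rw [lintegral_inv_norm_sq_orthogonalProjectionOnto hV]
    exact ENNReal.ofReal_ne_top
  filter_upwards [ae_lt_top (by fun_prop) h] with y hy hyV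
  rw [Submodule.orthogonalProjectionOnto_orthogonal_apply_eq_zero hyV] at hy
  simp at hy

lemma measurableSet_linearIndepOn {ι : Type*} [Fintype ι] (s : Finset ι) :
    MeasurableSet {X : ι → E | LinearIndepOn ℝ X s} := by
  have h : IsOpen {f : s → E | LinearIndependent ℝ f} := isOpen_setOfPred_linearIndependent
  exact (h.preimage (f := fun (X : ι → E) (j : s) ↦ X j) (by fun_prop)).measurableSet

variable {ι : Type*} [Fintype ι] [DecidableEq ι]

lemma ae_linearIndepOn_pi_stdGaussian (hE : Fintype.card ι + 2 ≤ finrank ℝ E) (s : Finset ι) :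
    ∀ᵐ X ∂(Measure.pi fun _ : ι ↦ stdGaussian E), LinearIndepOn ℝ X s := by
  induction s using Finset.induction_on with
  | empty => simp
  | insert i s hi ih =>
    have hmp := measurePreserving_update (fun _ : ι ↦ stdGaussian E) i
    rw [← hmp.map_eq, ae_map_iff hmp.measurable.aemeasurable (measurableSet_linearIndepOn _),
      Measure.ae_prod_iff_ae_ae
        (p := fun q ↦ LinearIndepOn ℝ (Function.update q.1 i q.2) ↑(insert i s))
        (hmp.measurable (measurableSet_linearIndepOn _))]
    filter_upwards [ih] with X hX
    have hcard : finrank ℝ (Submodule.span ℝ (X '' s)) ≤ s.card := by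
      classical
      rw [← Finset.coe_image]
      exact (finrank_span_finset_le_card _).trans Finset.card_image_le
    have hs : s.card < Fintype.card ι := Finset.card_lt_univ_of_notMem hi
    have hperp := (Submodule.span ℝ (X '' s)).finrank_add_finrank_orthogonal
    filter_upwards [ae_notMem_stdGaussian (V := Submodule.span ℝ (X '' s)) (by lia)] with y hy
    have hEq : Set.EqOn (Function.update X i y) X s := fun j hj ↦
      Function.update_of_ne (ne_of_mem_of_not_mem hj hi) _ _
    rw [Finset.coe_insert, linearIndepOn_insert (by exact_mod_cast hi), hEq.image_eq,
      Function.update_self, linearIndepOn_congr hEq]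
    exact ⟨hX, hy⟩

lemma ae_linearIndependent_pi_stdGaussian (hE : Fintype.card ι + 2 ≤ finrank ℝ E) :
    ∀ᵐ X ∂(Measure.pi fun _ : ι ↦ stdGaussian E), LinearIndependent ℝ X := by
  simpa [linearIndepOn_univ_iff] using ae_linearIndepOn_pi_stdGaussian hE (Finset.univ : Finset ι)

lemma ae_ae_gram_update_inv_diag_eq (hE : Fintype.card ι + 2 ≤ finrank ℝ E) (i : ι) :
    ∀ᵐ X ∂(Measure.pi fun _ : ι ↦ stdGaussian E),
      finrank ℝ (Submodule.span ℝ (X '' {i}ᶜ))ᗮ + Fintype.card ι = finrank ℝ E + 1 ∧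
      ∀ᵐ y ∂(stdGaussian E), ENNReal.ofReal ((gram ℝ (Function.update X i y))⁻¹ i i) =
        (ENNReal.ofReal
          (‖(Submodule.span ℝ (X '' {i}ᶜ))ᗮ.orthogonalProjectionOnto y‖ ^ 2))⁻¹ := by
  have hmp := measurePreserving_update (fun _ : ι ↦ stdGaussian E) i
  have hae := ae_linearIndependent_pi_stdGaussian hE
  filter_upwards [hae, Measure.ae_ae_of_ae_prod (hmp.quasiMeasurePreserving.ae hae)] with X hX hXy
  have hfr := finrank_orthogonal_span_image_compl hX i
  refine ⟨hfr, ?_⟩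
  have himage : ∀ y, Function.update X i y '' {i}ᶜ = X '' {i}ᶜ := fun y ↦
    Set.EqOn.image_eq fun j hj ↦ Function.update_of_ne hj _ _
  have hV : (Submodule.span ℝ (X '' {i}ᶜ))ᗮᗮ = Submodule.span ℝ (X '' {i}ᶜ) :=
    Submodule.orthogonal_orthogonal _
  filter_upwards [hXy, ae_notMem_stdGaussian (V := Submodule.span ℝ (X '' {i}ᶜ)) (by lia)]
    with y hy hyV
  rw [gram_inv_diag_eq hy, himage, Function.update_self, ENNReal.ofReal_inv_of_pos]
  refine pow_pos (norm_pos_iff.2 fun h0 ↦ hyV ?_) 2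
  rwa [Submodule.orthogonalProjectionOnto_eq_zero_iff, hV] at h0

lemma measurable_gram_inv_apply (i j : ι) :
    Measurable fun X : ι → E ↦ (gram ℝ X)⁻¹ i j :=
  measurable_inv_apply_of_entries (fun k l ↦ by simp only [gram_apply]; fun_prop) i j

lemma lintegral_gram_inv_diag (hE : Fintype.card ι + 2 ≤ finrank ℝ E) (i : ι) :
    ∫⁻ X, ENNReal.ofReal ((gram ℝ X)⁻¹ i i) ∂(Measure.pi fun _ : ι ↦ stdGaussian E) =
      ENNReal.ofReal (1 / (finrank ℝ E - Fintype.card ι - 1)) := by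
  have hmp := measurePreserving_update (fun _ : ι ↦ stdGaussian E) i
  have hm : Measurable fun X : ι → E ↦ ENNReal.ofReal ((gram ℝ X)⁻¹ i i) :=
    (measurable_gram_inv_apply i i).ennreal_ofReal
  have hm' := hm.comp hmp.measurable
  simp only [Function.comp_def] at hm'
  rw [← hmp.lintegral_comp hm, lintegral_prod _ hm'.aemeasurable]
  calc
    _ = ∫⁻ _, ENNReal.ofReal (1 / (finrank ℝ E - Fintype.card ι - 1))
          ∂(Measure.pi fun _ : ι ↦ stdGaussian E) := by
      refine lintegral_congr_ae ?_
      filter_upwards [ae_ae_gram_update_inv_diag_eq hE i] with X hX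
      rw [lintegral_congr_ae hX.2, lintegral_inv_norm_sq_orthogonalProjectionOnto (by lia)]
      have h := congrArg ((↑) : ℕ → ℝ) hX.1
      push_cast at h
      congr 2
      linarith
    _ = _ := by simp

lemma lintegral_gram_inv_diag_mul_norm_sq_lt_top (hE : Fintype.card ι + 2 ≤ finrank ℝ E)
    (i j : ι) :
    ∫⁻ X, ENNReal.ofReal ((gram ℝ X)⁻¹ i i) * ENNReal.ofReal (‖X j‖ ^ 2)
      ∂(Measure.pi fun _ : ι ↦ stdGaussian E) < ∞ := by
  have hmp := measurePreserving_update (fun _ : ι ↦ stdGaussian E) i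
  have hm : Measurable fun X : ι → E ↦
      ENNReal.ofReal ((gram ℝ X)⁻¹ i i) * ENNReal.ofReal (‖X j‖ ^ 2) :=
    (measurable_gram_inv_apply i i).ennreal_ofReal.mul (by fun_prop)
  set c := ∫⁻ y, ENNReal.ofReal (‖y‖ ^ 2) ∂(stdGaussian E)
  have hc : c < ∞ := lintegral_norm_sq_stdGaussian_lt_top
  have hm' := hm.comp hmp.measurable
  simp only [Function.comp_def] at hm'
  rw [← hmp.lintegral_comp hm, lintegral_prod _ hm'.aemeasurable]
  set r : ℝ := 1 / (finrank ℝ E - Fintype.card ι - 1)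
  calc
    _ ≤ ∫⁻ X, (1 + ENNReal.ofReal r * c + ENNReal.ofReal r * ENNReal.ofReal (‖X j‖ ^ 2))
          ∂(Measure.pi fun _ : ι ↦ stdGaussian E) := by
      refine lintegral_mono_ae ?_
      filter_upwards [ae_ae_gram_update_inv_diag_eq hE i] with X hX
      have hr : 1 / ((finrank ℝ (Submodule.span ℝ (X '' {i}ᶜ))ᗮ : ℝ) - 2) = r := by
        have h := congrArg ((↑) : ℕ → ℝ) hX.1
        push_cast at h
        simp only [r]
        congr 1
        linarith
      by_cases hj : j = i
      · subst hj
        refine le_trans (le_of_eq (lintegral_congr_ae ?_))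
          ((lintegral_inv_norm_sq_orthogonalProjectionOnto_mul_norm_sq_le
            (V := (Submodule.span ℝ (X '' {j}ᶜ))ᗮ) (by lia)).trans ?_)
        · filter_upwards [hX.2] with y hy
          rw [hy, Function.update_self]
        · rw [hr]
          exact le_self_add
      · refine le_trans (le_of_eq ?_) le_add_self
        rw [← hr, ← lintegral_inv_norm_sq_orthogonalProjectionOnto
            (V := (Submodule.span ℝ (X '' {i}ᶜ))ᗮ) (by lia),
          ← lintegral_mul_const _ (by fun_prop)]
        refine lintegral_congr_ae ?_
        filter_upwards [hX.2] with y hy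
        rw [hy, Function.update_of_ne hj]
    _ = 1 + ENNReal.ofReal r * c + ENNReal.ofReal r * c := by
      rw [lintegral_add_left measurable_const, lintegral_const_mul _ (by fun_prop),
        (measurePreserving_eval (fun _ : ι ↦ stdGaussian E) j).lintegral_comp
          (f := fun y ↦ ENNReal.ofReal (‖y‖ ^ 2)) (by fun_prop)]
      simp [c]
    _ < ∞ := by
      have : ENNReal.ofReal r * c < ∞ := ENNReal.mul_lt_top ENNReal.ofReal_lt_top hc
      simp [this]

end GramInverse

section SampleMoments

open scoped RealInnerProductSpace ENNReal

lemma measurePreserving_pi_swap {ι κ : Type*} [Fintype ι] [Fintype κ] {α : Type*}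
    [MeasurableSpace α] (μ : Measure α) [IsProbabilityMeasure μ] :
    MeasurePreserving (fun (x : ι → κ → α) j i ↦ x i j)
      (Measure.pi fun _ : ι ↦ Measure.pi fun _ : κ ↦ μ)
      (Measure.pi fun _ : κ ↦ Measure.pi fun _ : ι ↦ μ) := by
  have hm : Measurable fun (x : ι → κ → α) j i ↦ x i j := by fun_prop
  refine ⟨hm, (Measure.pi_eq_generateFrom
    (C := fun _ ↦ Set.univ.pi '' Set.univ.pi fun _ ↦ {s | MeasurableSet s})
    (fun _ ↦ generateFrom_pi) (fun _ ↦ isPiSystem_pi)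
    (fun _ ↦ ⟨fun _ ↦ Set.univ, fun _ ↦ ⟨fun _ ↦ Set.univ, fun _ _ ↦ MeasurableSet.univ,
      Set.pi_univ _⟩,
      fun _ ↦ measure_lt_top _ _, Set.iUnion_const _⟩)
    fun s hs ↦ ?_).symm⟩
  choose B hB hBs using hs
  have hBm : ∀ j i, MeasurableSet (B j i) := fun j i ↦ hB j i (Set.mem_univ i)
  have hpre : (fun (x : ι → κ → α) j i ↦ x i j) ⁻¹' Set.univ.pi s =
      Set.univ.pi fun i ↦ Set.univ.pi fun j ↦ B j i := by
    ext x
    simp only [← hBs, Set.mem_preimage, Set.mem_pi, Set.mem_univ, true_implies]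
    exact forall_comm
  rw [Measure.map_apply hm (MeasurableSet.univ_pi fun j ↦ hBs j ▸ MeasurableSet.univ_pi (hBm j)),
    hpre]
  simp_rw [← hBs, Measure.pi_pi]
  exact Finset.prod_comm

instance isProbabilityMeasure_stdGaussianPi : IsProbabilityMeasure (stdGaussianPi d) := by
  unfold stdGaussianPi
  infer_instance

/-- The `j`-th column of the design matrix with rows `x t`. -/
def designCol (x : Fin n → Fin d → ℝ) (j : Fin d) : EuclideanSpace ℝ (Fin n) :=
  WithLp.toLp 2 fun t ↦ x t j

/-- The second-moment matrix `∑ t, x_t x_tᵀ` of a sample. -/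
def sampleGram (x : Fin n → Fin d → ℝ) : Matrix (Fin d) (Fin d) ℝ :=
  ∑ t, vecMulVec (x t) (x t)

lemma sampleGram_apply (x : Fin n → Fin d → ℝ) (i j : Fin d) :
    sampleGram x i j = ∑ t, x t i * x t j := by
  simp [sampleGram, Matrix.sum_apply, vecMulVec_apply]

lemma gram_designCol (x : Fin n → Fin d → ℝ) : gram ℝ (designCol x) = sampleGram x := by
  ext i j
  simp [sampleGram_apply, designCol, PiLp.inner_apply, mul_comm]

lemma measurePreserving_designCol :
    MeasurePreserving (designCol : (Fin n → Fin d → ℝ) → _)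
      (Measure.pi fun _ : Fin n ↦ stdGaussianPi d)
      (Measure.pi fun _ : Fin d ↦ stdGaussian (EuclideanSpace ℝ (Fin n))) := by
  have h : MeasurePreserving (WithLp.toLp 2 : (Fin n → ℝ) → EuclideanSpace ℝ (Fin n))
      (Measure.pi fun _ ↦ gaussianReal 0 1) (stdGaussian (EuclideanSpace ℝ (Fin n))) :=
    ⟨by fun_prop, map_pi_eq_stdGaussian⟩
  exact (measurePreserving_pi _ _ fun _ : Fin d ↦ h).comp
    (measurePreserving_pi_swap (ι := Fin n) (κ := Fin d) (gaussianReal 0 1))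

lemma ae_det_sampleGram_ne_zero (hn : d + 2 ≤ n) :
    ∀ᵐ x ∂(Measure.pi fun _ : Fin n ↦ stdGaussianPi d), (sampleGram x).det ≠ 0 := by
  filter_upwards [measurePreserving_designCol.quasiMeasurePreserving.ae
    (ae_linearIndependent_pi_stdGaussian (E := EuclideanSpace ℝ (Fin n)) (ι := Fin d)
      (by simpa using hn))] with x hx
  rw [← gram_designCol]
  exact det_gram_ne_zero_iff_linearIndependent.2 hx

lemma measurable_sampleGram_inv_apply (i j : Fin d) :
    Measurable fun x : Fin n → Fin d → ℝ ↦ (sampleGram x)⁻¹ i j :=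
  measurable_inv_apply_of_entries (fun k l ↦ by simp only [sampleGram_apply]; fun_prop) i j

lemma sampleGram_inv_diag_nonneg (x : Fin n → Fin d → ℝ) (i : Fin d) :
    0 ≤ (sampleGram x)⁻¹ i i := by
  rw [← gram_designCol]
  exact (posSemidef_gram ℝ (designCol x)).inv.diag_nonneg

lemma lintegral_sampleGram_inv_diag (hn : d + 2 ≤ n) (i : Fin d) :
    ∫⁻ x, ENNReal.ofReal ((sampleGram x)⁻¹ i i) ∂(Measure.pi fun _ : Fin n ↦ stdGaussianPi d) =
      ENNReal.ofReal (1 / (n - d - 1)) := by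
  have h := lintegral_gram_inv_diag (E := EuclideanSpace ℝ (Fin n)) (ι := Fin d)
    (by simpa using hn) i
  rw [← measurePreserving_designCol.lintegral_comp
    (measurable_gram_inv_apply i i).ennreal_ofReal] at h
  simpa [gram_designCol] using h

lemma integrable_sampleGram_inv_diag (hn : d + 2 ≤ n) (i : Fin d) :
    Integrable (fun x ↦ (sampleGram x)⁻¹ i i) (Measure.pi fun _ : Fin n ↦ stdGaussianPi d) := by
  rw [← lintegral_ofReal_ne_top_iff_integrable
    (measurable_sampleGram_inv_apply i i).aestronglyMeasurable
    (ae_of_all _ fun x ↦ sampleGram_inv_diag_nonneg x i), lintegral_sampleGram_inv_diag hn]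
  exact ENNReal.ofReal_ne_top

lemma integrable_sampleGram_inv_trace (hn : d + 2 ≤ n) :
    Integrable (fun x ↦ (sampleGram x)⁻¹.trace) (Measure.pi fun _ : Fin n ↦ stdGaussianPi d) :=
  integrable_finsetSum _ fun i _ ↦ integrable_sampleGram_inv_diag hn i

lemma integral_sampleGram_inv_trace (hn : d + 2 ≤ n) :
    ∫ x, (sampleGram x)⁻¹.trace ∂(Measure.pi fun _ : Fin n ↦ stdGaussianPi d) =
      d / (n - d - 1) := by
  have hn' : (d : ℝ) + 2 ≤ n := by exact_mod_cast hn
  have h : ∀ i : Fin d, ∫ x, (sampleGram x)⁻¹ i i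
      ∂(Measure.pi fun _ : Fin n ↦ stdGaussianPi d) = 1 / (n - d - 1) := fun i ↦ by
    rw [integral_eq_lintegral_of_nonneg_ae (ae_of_all _ fun x ↦ sampleGram_inv_diag_nonneg x i)
      (measurable_sampleGram_inv_apply i i).aestronglyMeasurable,
      lintegral_sampleGram_inv_diag hn, ENNReal.toReal_ofReal]
    exact one_div_nonneg.2 (by linarith)
  simp only [trace, diag_apply]
  rw [integral_finsetSum _ fun i _ ↦ integrable_sampleGram_inv_diag hn i]
  simp [h, div_eq_mul_inv]

lemma integrable_sampleGram_inv_trace_mul_sum_sq (hn : d + 2 ≤ n) :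
    Integrable (fun x ↦ (sampleGram x)⁻¹.trace * ∑ j, ∑ t, x t j ^ 2)
      (Measure.pi fun _ : Fin n ↦ stdGaussianPi d) := by
  simp only [trace, diag_apply, Finset.sum_mul_sum]
  refine integrable_finsetSum _ fun i _ ↦ integrable_finsetSum _ fun j _ ↦ ?_
  have hnonneg : ∀ x : Fin n → Fin d → ℝ, 0 ≤ (sampleGram x)⁻¹ i i * ∑ t, x t j ^ 2 := fun x ↦
    mul_nonneg (sampleGram_inv_diag_nonneg x i) (by positivity)
  have hm : Measurable fun x : Fin n → Fin d → ℝ ↦ (sampleGram x)⁻¹ i i * ∑ t, x t j ^ 2 :=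
    (measurable_sampleGram_inv_apply i i).mul (by fun_prop)
  rw [← lintegral_ofReal_ne_top_iff_integrable hm.aestronglyMeasurable (ae_of_all _ hnonneg)]
  have h := lintegral_gram_inv_diag_mul_norm_sq_lt_top (E := EuclideanSpace ℝ (Fin n))
    (ι := Fin d) (by simpa using hn) i j
  have hm' : Measurable fun X : Fin d → EuclideanSpace ℝ (Fin n) ↦
      ENNReal.ofReal ((gram ℝ X)⁻¹ i i) * ENNReal.ofReal (‖X j‖ ^ 2) :=
    (measurable_gram_inv_apply i i).ennreal_ofReal.mul (by fun_prop)
  rw [← measurePreserving_designCol.lintegral_comp hm'] at h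
  have hnorm : ∀ x : Fin n → Fin d → ℝ, ‖designCol x j‖ ^ 2 = ∑ t, x t j ^ 2 := fun x ↦ by
    simp [designCol, EuclideanSpace.real_norm_sq_eq]
  simp_rw [gram_designCol, hnorm,
    ← ENNReal.ofReal_mul (sampleGram_inv_diag_nonneg _ i)] at h
  exact h.ne

end SampleMoments

section LinearChangeOfCovariates

variable {νη : Measure ℝ} {νa : Measure (Fin K → ℝ)}

lemma measurable_dotProduct {α ι : Type*} [MeasurableSpace α] [Fintype ι] {v w : α → ι → ℝ}
    (hv : Measurable v) (hw : Measurable w) : Measurable fun a ↦ v a ⬝ᵥ w a :=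
  Finset.measurable_sum _ fun i _ ↦
    ((measurable_pi_apply i).comp hv).mul ((measurable_pi_apply i).comp hw)

lemma measurable_mulVec {α ι κ : Type*} [MeasurableSpace α] [Fintype κ]
    {f : α → Matrix ι κ ℝ} {v : α → κ → ℝ} (hf : ∀ i j, Measurable fun a ↦ f a i j)
    (hv : Measurable v) : Measurable fun a ↦ f a *ᵥ v a :=
  measurable_pi_lambda _ fun i ↦ measurable_dotProduct (measurable_pi_lambda _ (hf i)) hv

lemma measurable_excessRisk_thetaBU (C : Matrix (Fin d) (Fin d) ℝ) (tgt θ : Fin d → ℝ)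
    (i : Fin K) :
    Measurable fun ω : HierOmega d n K ↦ excessRisk C tgt (thetaBU θ i ω) := by
  have hx : ∀ t, Measurable fun ω : HierOmega d n K ↦ ω.1 t := fun t ↦
    (measurable_pi_apply t).comp measurable_fst
  have hy : ∀ t, Measurable fun ω : HierOmega d n K ↦ yChild θ i t ω := fun t ↦
    Measurable.mul (by fun_prop)
      ((measurable_dotProduct measurable_const (hx t)).add (by fun_prop))
  have hest : Measurable fun ω : HierOmega d n K ↦ thetaBU θ i ω - tgt :=
    (measurable_mulVec (fun k l ↦ (measurable_sampleGram_inv_apply k l).comp measurable_fst)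
      (Finset.measurable_sum _ fun t _ ↦ (hy t).smul (hx t))).sub_const tgt
  exact measurable_dotProduct hest (measurable_mulVec (fun _ _ ↦ measurable_const) hest)

lemma measurePreserving_hierMeasure {ν : Measure (Fin d → ℝ)} [IsProbabilityMeasure ν]
    [IsProbabilityMeasure νη] [IsProbabilityMeasure νa] {f : (Fin d → ℝ) → Fin d → ℝ}
    (hf : Measurable f) :
    MeasurePreserving (fun ω : HierOmega d n K ↦ (⟨fun t ↦ f (ω.1 t), ω.2⟩ : HierOmega d n K))
      (hierMeasure d n K ν νη νa) (hierMeasure d n K (ν.map f) νη νa) := by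
  have : IsProbabilityMeasure (ν.map f) := Measure.isProbabilityMeasure_map hf.aemeasurable
  have h : MeasurePreserving f ν (ν.map f) := ⟨hf, rfl⟩
  exact (measurePreserving_pi (fun _ : Fin n ↦ ν) _ fun _ ↦ h).prod (MeasurePreserving.id _)

lemma excessRisk_thetaBU_mulVec {A : Matrix (Fin d) (Fin d) ℝ} (hA : IsUnit A.det)
    (q : ℝ) (θ : Fin d → ℝ) (i : Fin K) (ω : HierOmega d n K) :
    excessRisk (A * Aᵀ) (q • θ) (thetaBU θ i ⟨fun t ↦ A *ᵥ ω.1 t, ω.2⟩) =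
      excessRisk 1 (q • Aᵀ *ᵥ θ) (thetaBU (Aᵀ *ᵥ θ) i ω) := by
  have hA' : IsUnit Aᵀ.det := by rwa [det_transpose]
  have hS : Smat (⟨fun t ↦ A *ᵥ ω.1 t, ω.2⟩ : HierOmega d n K) = A * Smat ω * Aᵀ := by
    simp only [Smat, Finset.mul_sum, Finset.sum_mul]
    refine Finset.sum_congr rfl fun t _ ↦ ?_
    rw [mul_vecMulVec, vecMulVec_mul, vecMul_transpose]
  have hy : ∀ t, yChild θ i t (⟨fun t ↦ A *ᵥ ω.1 t, ω.2⟩ : HierOmega d n K) =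
      yChild (Aᵀ *ᵥ θ) i t ω := fun t ↦ by
    simp only [yChild, yRoot, dotProduct_mulVec, mulVec_transpose]
  have hest : Aᵀ *ᵥ thetaBU θ i (⟨fun t ↦ A *ᵥ ω.1 t, ω.2⟩ : HierOmega d n K) =
      thetaBU (Aᵀ *ᵥ θ) i ω := by
    simp only [thetaBU, hS, hy, ← mulVec_smul, ← mulVec_sum, Matrix.mul_inv_rev, mulVec_mulVec]
    rw [← Matrix.mul_assoc, ← Matrix.mul_assoc, mul_nonsing_inv _ hA', Matrix.one_mul,
      Matrix.mul_assoc, nonsing_inv_mul _ hA, Matrix.mul_one]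
  simp only [excessRisk, one_mulVec, ← hest, ← mulVec_smul, ← mulVec_sub, ← mulVec_mulVec]
  rw [dotProduct_mulVec, ← mulVec_transpose]

lemma integral_excessRisk_thetaBU_map [IsProbabilityMeasure νη] [IsProbabilityMeasure νa]
    {A : Matrix (Fin d) (Fin d) ℝ} (hA : IsUnit A.det) (q : ℝ) (θ : Fin d → ℝ) (i : Fin K) :
    ∫ ω, excessRisk (A * Aᵀ) (q • θ) (thetaBU θ i ω)
        ∂(hierMeasure d n K ((stdGaussianPi d).map fun z ↦ A *ᵥ z) νη νa) =
      ∫ ω, excessRisk 1 (q • Aᵀ *ᵥ θ) (thetaBU (Aᵀ *ᵥ θ) i ω)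
        ∂(hierMeasure d n K (stdGaussianPi d) νη νa) := by
  have h := measurePreserving_hierMeasure (n := n) (ν := stdGaussianPi d) (νη := νη) (νa := νa)
    (f := fun z ↦ A *ᵥ z) (Continuous.matrix_mulVec continuous_const continuous_id).measurable
  rw [← h.map_eq, integral_map h.measurable.aemeasurable
    (measurable_excessRisk_thetaBU _ _ _ _).aestronglyMeasurable]
  simp only [excessRisk_thetaBU_mulVec hA]

end LinearChangeOfCovariates

section OLSWeights

lemma sum_smul_dotProduct_sum_smul {ι κ : Type*} [Fintype ι] [Fintype κ] (c e : ι → ℝ)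
    (g : ι → κ → ℝ) :
    (∑ t, c t • g t) ⬝ᵥ (∑ t, e t • g t) = ∑ t, ∑ t', c t * e t' * (g t ⬝ᵥ g t') := by
  simp only [sum_dotProduct, smul_dotProduct]
  simp only [dotProduct_sum, dotProduct_smul, smul_eq_mul, Finset.mul_sum, mul_assoc]

/-- The weight vector `S⁻¹ x_t` of the `t`-th response in the least squares estimator. -/
def olsWeight (x : Fin n → Fin d → ℝ) (t : Fin n) : Fin d → ℝ :=
  (sampleGram x)⁻¹ *ᵥ x t

lemma measurable_olsWeight_dotProduct (t t' : Fin n) :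
    Measurable fun x : Fin n → Fin d → ℝ ↦ olsWeight x t ⬝ᵥ olsWeight x t' := by
  have h : ∀ t, Measurable fun x : Fin n → Fin d → ℝ ↦ olsWeight x t := fun t ↦
    measurable_mulVec measurable_sampleGram_inv_apply (measurable_pi_apply t)
  exact measurable_dotProduct (h t) (h t')

lemma sum_dotProduct_smul_olsWeight {x : Fin n → Fin d → ℝ} (hx : (sampleGram x).det ≠ 0)
    (θ : Fin d → ℝ) : ∑ t, (θ ⬝ᵥ x t) • olsWeight x t = θ := by
  have h : ∑ t, (θ ⬝ᵥ x t) • x t = sampleGram x *ᵥ θ := by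
    simp only [sampleGram, sum_mulVec, vecMulVec_mulVec, dotProduct_comm θ, op_smul_eq_smul]
  simp only [olsWeight, ← mulVec_smul, ← mulVec_sum]
  rw [h, mulVec_mulVec, nonsing_inv_mul _ (isUnit_iff_ne_zero.2 hx), one_mulVec]

lemma sum_olsWeight_dotProduct_self {x : Fin n → Fin d → ℝ} (hx : (sampleGram x).det ≠ 0) :
    ∑ t, olsWeight x t ⬝ᵥ olsWeight x t = (sampleGram x)⁻¹.trace := by
  have hT : (sampleGram x)ᵀ = sampleGram x := by
    ext i j
    simp [sampleGram_apply, mul_comm]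
  have h : ∑ t, vecMulVec (olsWeight x t) (olsWeight x t) = (sampleGram x)⁻¹ := by
    calc ∑ t, vecMulVec (olsWeight x t) (olsWeight x t)
        = (sampleGram x)⁻¹ * sampleGram x * (sampleGram x)⁻¹ᵀ := by
          conv_rhs => rw [sampleGram]
          simp only [Finset.mul_sum, Finset.sum_mul, mul_vecMulVec, vecMulVec_mul,
            vecMul_transpose]
          rfl
      _ = (sampleGram x)⁻¹ := by
          rw [nonsing_inv_mul _ (isUnit_iff_ne_zero.2 hx), transpose_nonsing_inv, hT,
            Matrix.one_mul]
  conv_rhs => rw [← h]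
  simp [trace_sum, trace_vecMulVec]

lemma abs_dotProduct_le {ι : Type*} [Fintype ι] (v w : ι → ℝ) :
    |v ⬝ᵥ w| ≤ (v ⬝ᵥ v + w ⬝ᵥ w) / 2 := by
  simp only [dotProduct, ← Finset.sum_add_distrib, Finset.sum_div]
  refine (Finset.abs_sum_le_sum_abs _ _).trans (Finset.sum_le_sum fun i _ ↦ ?_)
  rw [abs_le]
  constructor <;> nlinarith [sq_nonneg (v i + w i), sq_nonneg (v i - w i)]

lemma dotProduct_self_nonneg_real {ι : Type*} [Fintype ι] (v : ι → ℝ) : 0 ≤ v ⬝ᵥ v :=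
  Finset.sum_nonneg fun i _ ↦ mul_self_nonneg (v i)

lemma abs_olsWeight_dotProduct_le {x : Fin n → Fin d → ℝ} (hx : (sampleGram x).det ≠ 0)
    (t t' : Fin n) : |olsWeight x t ⬝ᵥ olsWeight x t'| ≤ (sampleGram x)⁻¹.trace := by
  have h : ∀ r, olsWeight x r ⬝ᵥ olsWeight x r ≤ (sampleGram x)⁻¹.trace := fun r ↦ by
    rw [← sum_olsWeight_dotProduct_self hx]
    exact Finset.single_le_sum (f := fun r ↦ olsWeight x r ⬝ᵥ olsWeight x r)
      (fun r _ ↦ dotProduct_self_nonneg_real _) (Finset.mem_univ r)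
  linarith [abs_dotProduct_le (olsWeight x t) (olsWeight x t'), h t, h t']

lemma dotProduct_sq_le (θ : Fin d → ℝ) (x : Fin n → Fin d → ℝ) (t : Fin n) :
    (θ ⬝ᵥ x t) ^ 2 ≤ (θ ⬝ᵥ θ) * ∑ j, ∑ t, x t j ^ 2 := by
  have h1 : (θ ⬝ᵥ x t) ^ 2 ≤ (∑ j, θ j ^ 2) * ∑ j, x t j ^ 2 :=
    Finset.sum_mul_sq_le_sq_mul_sq _ _ _
  have h2 : ∑ j, θ j ^ 2 = θ ⬝ᵥ θ := by simp [dotProduct, sq]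
  rw [h2] at h1
  refine h1.trans (mul_le_mul_of_nonneg_left (Finset.sum_le_sum fun j _ ↦ ?_)
    (dotProduct_self_nonneg_real θ))
  exact Finset.single_le_sum (f := fun t ↦ x t j ^ 2) (fun t _ ↦ sq_nonneg _) (Finset.mem_univ t)

/-- Products of least squares weights with a function of at most quadratic growth are
integrable. -/
lemma integrable_olsWeight_dotProduct_mul (hn : d + 2 ≤ n) (t t' : Fin n)
    {f : (Fin n → Fin d → ℝ) → ℝ} (hf : Measurable f) (c : ℝ)
    (hfc : ∀ x, |f x| ≤ 1 + c * ∑ j, ∑ t, x t j ^ 2) :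
    Integrable (fun x ↦ olsWeight x t ⬝ᵥ olsWeight x t' * f x)
      (Measure.pi fun _ : Fin n ↦ stdGaussianPi d) := by
  refine ((integrable_sampleGram_inv_trace hn).add
    ((integrable_sampleGram_inv_trace_mul_sum_sq hn).const_mul c)).mono'
    ((measurable_olsWeight_dotProduct t t').mul hf).aestronglyMeasurable ?_
  filter_upwards [ae_det_sampleGram_ne_zero hn] with x hx
  have h := abs_olsWeight_dotProduct_le hx t t'
  rw [Real.norm_eq_abs, abs_mul]
  refine (mul_le_mul h (hfc x) (abs_nonneg _) ((abs_nonneg _).trans h)).trans_eq ?_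
  simp only [Pi.add_apply]
  ring

end OLSWeights

section RiskDecomposition

variable {νx : Measure (Fin d → ℝ)} {νη : Measure ℝ} {νa : Measure (Fin K → ℝ)}

lemma integrable_mul_hierMeasure [IsProbabilityMeasure νx] [IsProbabilityMeasure νη]
    [IsProbabilityMeasure νa] {f : (Fin n → Fin d → ℝ) → ℝ} {g : (Fin n → ℝ) → ℝ}
    {h : (Fin n → Fin K → ℝ) → ℝ} (hf : Integrable f (Measure.pi fun _ ↦ νx))
    (hg : Integrable g (Measure.pi fun _ ↦ νη)) (hh : Integrable h (Measure.pi fun _ ↦ νa)) :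
    Integrable (fun ω : HierOmega d n K ↦ f ω.1 * (g ω.2.1 * h ω.2.2))
      (hierMeasure d n K νx νη νa) :=
  hf.mul_prod (hg.mul_prod hh)

lemma integral_mul_hierMeasure [IsProbabilityMeasure νx] [IsProbabilityMeasure νη]
    [IsProbabilityMeasure νa] (f : (Fin n → Fin d → ℝ) → ℝ) (g : (Fin n → ℝ) → ℝ)
    (h : (Fin n → Fin K → ℝ) → ℝ) :
    ∫ ω, f ω.1 * (g ω.2.1 * h ω.2.2) ∂(hierMeasure d n K νx νη νa) =
      (∫ x, f x ∂(Measure.pi fun _ ↦ νx)) *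
        ((∫ e, g e ∂(Measure.pi fun _ ↦ νη)) * ∫ a, h a ∂(Measure.pi fun _ ↦ νa)) := by
  rw [hierMeasure, integral_prod_mul f (fun z : (Fin n → ℝ) × (Fin n → Fin K → ℝ) ↦
    g z.1 * h z.2), integral_prod_mul g h]

lemma integral_pi_eval [IsProbabilityMeasure νη] (hmean : ∫ e, e ∂νη = 0) (t : Fin n) :
    ∫ e, e t ∂(Measure.pi fun _ : Fin n ↦ νη) = 0 := by
  rw [← hmean]
  exact integral_comp_eval (μ := fun _ : Fin n ↦ νη) (i := t) (f := fun e ↦ e)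
    aestronglyMeasurable_id

lemma integral_pi_mul_eval [IsProbabilityMeasure νη] {σ : ℝ} (hmean : ∫ e, e ∂νη = 0)
    (hvar : ∫ e, e ^ 2 ∂νη = σ ^ 2) (t t' : Fin n) :
    ∫ e, e t * e t' ∂(Measure.pi fun _ ↦ νη) = if t = t' then σ ^ 2 else 0 := by
  split_ifs with h
  · subst h
    simp_rw [← sq]
    rw [← hvar]
    exact integral_comp_eval (μ := fun _ : Fin n ↦ νη) (i := t) (f := fun e ↦ e ^ 2)
      (by fun_prop)
  · have hind : iIndepFun (fun (i : Fin n) (e : Fin n → ℝ) ↦ e i) (Measure.pi fun _ ↦ νη) :=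
      iIndepFun_pi (X := fun _ e ↦ e) fun _ ↦ aemeasurable_id
    rw [(hind.indepFun h).integral_fun_mul_eq_mul_integral
      (measurable_pi_apply t).aestronglyMeasurable (measurable_pi_apply t').aestronglyMeasurable,
      integral_pi_eval hmean, zero_mul]

lemma excessRisk_thetaBU_eq {ω : HierOmega d n K} (hω : (Smat ω).det ≠ 0) (q : ℝ)
    (θ : Fin d → ℝ) (i : Fin K) :
    excessRisk 1 (q • θ) (thetaBU θ i ω) =
      (∑ t, ∑ t', olsWeight ω.1 t ⬝ᵥ olsWeight ω.1 t' * ((θ ⬝ᵥ ω.1 t) * (θ ⬝ᵥ ω.1 t')) *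
        (1 * ((ω.2.2 t i - q) * (ω.2.2 t' i - q)))) +
      2 * (∑ t, ∑ t', olsWeight ω.1 t ⬝ᵥ olsWeight ω.1 t' * (θ ⬝ᵥ ω.1 t) *
        (ω.2.1 t' * ((ω.2.2 t i - q) * ω.2.2 t' i))) +
      ∑ t, ∑ t', olsWeight ω.1 t ⬝ᵥ olsWeight ω.1 t' *
        (ω.2.1 t * ω.2.1 t' * (ω.2.2 t i * ω.2.2 t' i)) := by
  set V := ∑ t, ((θ ⬝ᵥ ω.1 t) * (ω.2.2 t i - q)) • olsWeight ω.1 t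
  set W := ∑ t, (ω.2.1 t * ω.2.2 t i) • olsWeight ω.1 t
  have hθ : q • θ = ∑ t, (q * (θ ⬝ᵥ ω.1 t)) • olsWeight ω.1 t := by
    conv_lhs => rw [← sum_dotProduct_smul_olsWeight hω θ]
    simp only [Finset.smul_sum, smul_smul]
  have hest : thetaBU θ i ω = ∑ t, yChild θ i t ω • olsWeight ω.1 t := by
    simp only [thetaBU, mulVec_sum, mulVec_smul]
    rfl
  have h : thetaBU θ i ω - q • θ = V + W := by
    rw [hest, hθ, ← Finset.sum_sub_distrib, ← Finset.sum_add_distrib]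
    refine Finset.sum_congr rfl fun t _ ↦ ?_
    rw [← sub_smul, ← add_smul, yChild, yRoot]
    congr 1
    ring
  rw [excessRisk, one_mulVec, h, add_dotProduct, dotProduct_add, dotProduct_add,
    dotProduct_comm W V, show ∀ a b c : ℝ, a + b + (b + c) = a + 2 * b + c by intros; ring]
  simp only [V, W, sum_smul_dotProduct_sum_smul]
  refine congr_arg₂ (· + ·) (congr_arg₂ (· + ·) ?_ (congr_arg (2 * ·) ?_)) ?_ <;>
    exact Finset.sum_congr rfl fun t _ ↦ Finset.sum_congr rfl fun t' _ ↦ by ring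

lemma le_integral_excessRisk_thetaBU_stdGaussianPi [IsProbabilityMeasure νη]
    [IsProbabilityMeasure νa] (hn : d + 2 ≤ n) (θ : Fin d → ℝ) {σ : ℝ}
    (hη : MemLp id 2 νη) (hηmean : ∫ e, e ∂νη = 0) (hηvar : ∫ e, e ^ 2 ∂νη = σ ^ 2)
    (i : Fin K) {p s : ℝ} (ha : MemLp (fun v : Fin K → ℝ ↦ v i) 2 νa)
    (hamean : ∫ v, v i ∂νa = p) (havar : ∫ v, (v i - p) ^ 2 ∂νa = s) :
    (s + p ^ 2) * σ ^ 2 * d / (n - d - 1) ≤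
      ∫ ω, excessRisk 1 (p • θ) (thetaBU θ i ω)
        ∂(hierMeasure d n K (stdGaussianPi d) νη νa) := by
  set μ := hierMeasure d n K (stdGaussianPi d) νη νa
  have hηt : ∀ t : Fin n, MemLp (fun e : Fin n → ℝ ↦ e t) 2 (Measure.pi fun _ ↦ νη) := fun t ↦
    hη.comp_measurePreserving (measurePreserving_eval (fun _ : Fin n ↦ νη) t)
  have hat : ∀ t : Fin n, MemLp (fun a : Fin n → Fin K → ℝ ↦ a t i) 2
      (Measure.pi fun _ ↦ νa) := fun t ↦
    ha.comp_measurePreserving (measurePreserving_eval (fun _ : Fin n ↦ νa) t)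
  have hat' : ∀ t : Fin n, MemLp (fun a : Fin n → Fin K → ℝ ↦ a t i - p) 2
      (Measure.pi fun _ ↦ νa) := fun t ↦ (hat t).sub (memLp_const p)
  have hasq : ∫ v, v i ^ 2 ∂νa = s + p ^ 2 := by
    have hint := ha.integrable one_le_two
    have h : ∀ v : Fin K → ℝ, v i ^ 2 = (v i - p) ^ 2 + 2 * p * v i + -p ^ 2 := fun v ↦ by ring
    have hint' := hint.const_mul (2 * p)
    have hsq : Integrable (fun v : Fin K → ℝ ↦ (v i - p) ^ 2) νa :=
      (ha.sub (memLp_const p)).integrable_sq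
    simp_rw [h]
    rw [integral_add (hsq.fun_add hint') (integrable_const _), integral_add hsq hint',
      integral_const_mul, havar, hamean]
    simp
    ring
  have hasqt : ∀ t : Fin n, ∫ a, a t i * a t i ∂(Measure.pi fun _ : Fin n ↦ νa) = s + p ^ 2 := by
    intro t
    simp_rw [← sq]
    rw [← hasq]
    exact integral_comp_eval (μ := fun _ : Fin n ↦ νa) (i := t) (f := fun v ↦ v i ^ 2)
      ((measurable_pi_apply i).pow_const 2).aestronglyMeasurable
  have hu : ∀ t, Measurable fun x : Fin n → Fin d → ℝ ↦ θ ⬝ᵥ x t := fun t ↦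
    measurable_dotProduct measurable_const (measurable_pi_apply t)
  have hG : ∀ t t', Integrable (fun x : Fin n → Fin d → ℝ ↦ olsWeight x t ⬝ᵥ olsWeight x t')
      (Measure.pi fun _ ↦ stdGaussianPi d) := fun t t' ↦ by
    simpa using integrable_olsWeight_dotProduct_mul hn t t' (f := fun _ ↦ 1) measurable_const 0
      (by simp)
  have hGu : ∀ t t', Integrable (fun x : Fin n → Fin d → ℝ ↦
      olsWeight x t ⬝ᵥ olsWeight x t' * (θ ⬝ᵥ x t))
      (Measure.pi fun _ ↦ stdGaussianPi d) := fun t t' ↦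
    integrable_olsWeight_dotProduct_mul hn t t' (hu t) (θ ⬝ᵥ θ) fun x ↦ by
      refine le_trans ?_ (add_le_add_right (dotProduct_sq_le θ x t) 1)
      rw [← sq_abs]
      nlinarith [sq_nonneg (|θ ⬝ᵥ x t| - 1)]
  have hGuu : ∀ t t', Integrable (fun x : Fin n → Fin d → ℝ ↦
      olsWeight x t ⬝ᵥ olsWeight x t' * ((θ ⬝ᵥ x t) * (θ ⬝ᵥ x t')))
      (Measure.pi fun _ ↦ stdGaussianPi d) := fun t t' ↦
    integrable_olsWeight_dotProduct_mul hn t t' ((hu t).mul (hu t')) (θ ⬝ᵥ θ) fun x ↦ by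
      have h1 := dotProduct_sq_le θ x t
      have h2 := dotProduct_sq_le θ x t'
      rw [abs_le]
      constructor <;> nlinarith [sq_nonneg (θ ⬝ᵥ x t + θ ⬝ᵥ x t'), sq_nonneg (θ ⬝ᵥ x t - θ ⬝ᵥ x t')]
  have hI1 : ∀ t t', Integrable (fun ω : HierOmega d n K ↦
      olsWeight ω.1 t ⬝ᵥ olsWeight ω.1 t' * ((θ ⬝ᵥ ω.1 t) * (θ ⬝ᵥ ω.1 t')) *
        (1 * ((ω.2.2 t i - p) * (ω.2.2 t' i - p)))) μ := fun t t' ↦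
    integrable_mul_hierMeasure (hGuu t t') (g := fun _ ↦ 1) (integrable_const 1)
      ((hat' t).integrable_mul (hat' t'))
  have hI2 : ∀ t t', Integrable (fun ω : HierOmega d n K ↦
      olsWeight ω.1 t ⬝ᵥ olsWeight ω.1 t' * (θ ⬝ᵥ ω.1 t) *
        (ω.2.1 t' * ((ω.2.2 t i - p) * ω.2.2 t' i))) μ := fun t t' ↦
    integrable_mul_hierMeasure (hGu t t') ((hηt t').integrable one_le_two)
      ((hat' t).integrable_mul (hat t'))
  have hI3 : ∀ t t', Integrable (fun ω : HierOmega d n K ↦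
      olsWeight ω.1 t ⬝ᵥ olsWeight ω.1 t' *
        (ω.2.1 t * ω.2.1 t' * (ω.2.2 t i * ω.2.2 t' i))) μ := fun t t' ↦
    integrable_mul_hierMeasure (hG t t') ((hηt t).integrable_mul (hηt t'))
      ((hat t).integrable_mul (hat t'))
  have hdet : ∀ᵐ x ∂(Measure.pi fun _ : Fin n ↦ stdGaussianPi d), (sampleGram x).det ≠ 0 :=
    ae_det_sampleGram_ne_zero hn
  have hdet' : ∀ᵐ ω ∂μ, (Smat ω).det ≠ 0 := Measure.quasiMeasurePreserving_fst.ae hdet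
  have hS1 := integrable_finsetSum univ fun t _ ↦ integrable_finsetSum univ fun t' _ ↦ hI1 t t'
  have hS2 := integrable_finsetSum univ fun t _ ↦ integrable_finsetSum univ fun t' _ ↦ hI2 t t'
  have hS3 := integrable_finsetSum univ fun t _ ↦ integrable_finsetSum univ fun t' _ ↦ hI3 t t'
  have h1 : 0 ≤ ∫ ω, ∑ t, ∑ t', olsWeight ω.1 t ⬝ᵥ olsWeight ω.1 t' *
      ((θ ⬝ᵥ ω.1 t) * (θ ⬝ᵥ ω.1 t')) * (1 * ((ω.2.2 t i - p) * (ω.2.2 t' i - p))) ∂μ := by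
    refine integral_nonneg fun ω ↦ ?_
    have h := dotProduct_self_nonneg_real
      (∑ t, ((θ ⬝ᵥ ω.1 t) * (ω.2.2 t i - p)) • olsWeight ω.1 t)
    rw [sum_smul_dotProduct_sum_smul] at h
    exact h.trans_eq (Finset.sum_congr rfl fun t _ ↦ Finset.sum_congr rfl fun t' _ ↦ by ring)
  have h2 : ∫ ω, ∑ t, ∑ t', olsWeight ω.1 t ⬝ᵥ olsWeight ω.1 t' * (θ ⬝ᵥ ω.1 t) *
      (ω.2.1 t' * ((ω.2.2 t i - p) * ω.2.2 t' i)) ∂μ = 0 := by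
    rw [integral_finsetSum _ fun t _ ↦ integrable_finsetSum _ fun t' _ ↦ hI2 t t']
    refine Finset.sum_eq_zero fun t _ ↦ ?_
    rw [integral_finsetSum _ fun t' _ ↦ hI2 t t']
    refine Finset.sum_eq_zero fun t' _ ↦ ?_
    refine (integral_mul_hierMeasure (fun x ↦ olsWeight x t ⬝ᵥ olsWeight x t' * (θ ⬝ᵥ x t))
      (fun e ↦ e t') (fun a ↦ (a t i - p) * a t' i)).trans ?_
    rw [integral_pi_eval hηmean, zero_mul, mul_zero]
  have h3 : ∫ ω, ∑ t, ∑ t', olsWeight ω.1 t ⬝ᵥ olsWeight ω.1 t' *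
      (ω.2.1 t * ω.2.1 t' * (ω.2.2 t i * ω.2.2 t' i)) ∂μ =
        (s + p ^ 2) * σ ^ 2 * d / (n - d - 1) := by
    rw [integral_finsetSum _ fun t _ ↦ integrable_finsetSum _ fun t' _ ↦ hI3 t t']
    have h : ∀ t, ∫ ω, ∑ t', olsWeight ω.1 t ⬝ᵥ olsWeight ω.1 t' *
        (ω.2.1 t * ω.2.1 t' * (ω.2.2 t i * ω.2.2 t' i)) ∂μ =
        (∫ x, olsWeight x t ⬝ᵥ olsWeight x t ∂(Measure.pi fun _ ↦ stdGaussianPi d)) *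
          (σ ^ 2 * (s + p ^ 2)) := fun t ↦ by
      rw [integral_finsetSum _ fun t' _ ↦ hI3 t t', Finset.sum_eq_single t]
      · refine (integral_mul_hierMeasure (fun x ↦ olsWeight x t ⬝ᵥ olsWeight x t)
          (fun e ↦ e t * e t) (fun a ↦ a t i * a t i)).trans ?_
        rw [integral_pi_mul_eval hηmean hηvar, if_pos rfl, hasqt]
      · intro t' _ ht'
        refine (integral_mul_hierMeasure (fun x ↦ olsWeight x t ⬝ᵥ olsWeight x t')
          (fun e ↦ e t * e t') (fun a ↦ a t i * a t' i)).trans ?_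
        rw [integral_pi_mul_eval hηmean hηvar, if_neg ht'.symm, zero_mul, mul_zero]
      · simp
    simp_rw [h]
    rw [← Finset.sum_mul, ← integral_finsetSum _ fun t _ ↦ hG t t,
      integral_congr_ae (hdet.mono fun x hx ↦ sum_olsWeight_dotProduct_self hx),
      integral_sampleGram_inv_trace hn]
    ring
  rw [integral_congr_ae (hdet'.mono fun ω hω ↦ excessRisk_thetaBU_eq hω p θ i),
    integral_add (hS1.fun_add (hS2.const_mul 2)) hS3, integral_add hS1 (hS2.const_mul 2),
    integral_const_mul, h2, h3]
  linarith

end RiskDecomposition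

/-- In the two-level hierarchical linear regression model, the total
expected excess risk of the bottom-up OLS estimators over all `K` children satisfies
`∑ i, E[r_i(θ̂ᵇ_i)] ≥ ∑ i, (s_i + p_i²) · σ² · d / (n − d − 1)`. -/
theorem bottomUp_total_excess_risk_lower_bound
    (d n K : ℕ) (hd : 1 ≤ d) (hn : d + 2 ≤ n)
    (C : Matrix (Fin d) (Fin d) ℝ) (hC : C.PosDef)
    (θ₀ : Fin d → ℝ) (σ : ℝ)
    (νx : Measure (Fin d → ℝ)) (νη : Measure ℝ) (νa : Measure (Fin K → ℝ))
    [IsProbabilityMeasure νη] [IsProbabilityMeasure νa]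
    (hx : IsCenteredGaussian νx C)
    (hηmean : ∫ e, e ∂νη = 0)
    (hηvar : ∫ e, e ^ 2 ∂νη = σ ^ 2)
    (p s : Fin K → ℝ)
    (hamean : ∀ i, ∫ v, v i ∂νa = p i)
    (havar : ∀ i, ∫ v, (v i - p i) ^ 2 ∂νa = s i)
    (habdd : ∃ M : ℝ, ∀ᵐ v ∂νa, ∀ i, |v i| ≤ M) :
    (∑ i, (s i + p i ^ 2)) * σ ^ 2 * d / ((n : ℝ) - d - 1) ≤
      ∑ i : Fin K, ∫ ω, excessRisk C (p i • θ₀) (thetaBU θ₀ i ω)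
        ∂(hierMeasure d n K νx νη νa) := by
  obtain ⟨A, rfl, rfl⟩ := hx
  have hnonneg : ∀ i : Fin K, 0 ≤ ∫ ω, excessRisk (A * Aᵀ) (p i • θ₀) (thetaBU θ₀ i ω)
      ∂(hierMeasure d n K ((stdGaussianPi d).map fun z ↦ A *ᵥ z) νη νa) := fun i ↦
    integral_nonneg fun ω ↦ hC.posSemidef.dotProduct_mulVec_nonneg _
  rcases eq_or_ne σ 0 with rfl | hσ
  · simpa using Finset.sum_nonneg fun i _ ↦ hnonneg i
  have hA : IsUnit A.det := by
    have h := hC.det_pos.ne'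
    rw [det_mul] at h
    exact isUnit_iff_ne_zero.2 (left_ne_zero_of_mul h)
  have hη : MemLp id 2 νη := by
    rw [memLp_two_iff_integrable_sq aestronglyMeasurable_id]
    by_contra h
    rw [show ∫ e, e ^ 2 ∂νη = 0 from integral_undef h] at hηvar
    exact hσ (pow_eq_zero_iff two_ne_zero |>.1 hηvar.symm)
  obtain ⟨M, hM⟩ := habdd
  have ha : ∀ i, MemLp (fun v : Fin K → ℝ ↦ v i) 2 νa := fun i ↦
    MemLp.of_bound (measurable_pi_apply i).aestronglyMeasurable M (hM.mono fun v hv ↦ hv i)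
  simp only [Finset.sum_mul, Finset.sum_div]
  refine Finset.sum_le_sum fun i _ ↦ ?_
  rw [integral_excessRisk_thetaBU_map hA]
  exact le_integral_excessRisk_thetaBU_stdGaussianPi hn (Aᵀ *ᵥ θ₀) hη hηmean hηvar i (ha i)
    (hamean i) (havar i)

end
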